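/- arXiv:2104.14742 — 4 statements merged into one kernel-verified Lean document; each statement's English description precedes it below -/
import Mathlib

section
/- Let n ≥ 3 and let φ be a symmetric nonnegative real function. Suppose that φ(i,j) < ((n−1)/n)·(1/i + 1/j)·φ(1,n−1) for every pair of integers (i,j) with 1 ≤ i ≤ j ≤ n−1 and (i,j) ≠ (1,n−1). Then for every digraph D on n vertices without isolated vertices, I(D) ≤ (n−1)·φ(1,n−1), and equality holds if and only if every arc (u,v) of D satisfies {d⁺(u), d⁻(v)} = {1, n−1} and every vertex w of D satisfies d⁺(w) ≥ 1 and d⁻(w) ≥ 1. -/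
open Finset

/-- The out-degree of a vertex `u` in the digraph on `Fin n` with arc set `A`. -/
def outDeg {n : ℕ} (A : Finset (Fin n × Fin n)) (u : Fin n) : ℕ :=
  (A.filter (fun a => a.1 = u)).card

/-- The in-degree of a vertex `u` in the digraph on `Fin n` with arc set `A`. -/
def inDeg {n : ℕ} (A : Finset (Fin n × Fin n)) (u : Fin n) : ℕ :=
  (A.filter (fun a => a.2 = u)).card

/-- The vertex-degree-based invariant `I(D) = (1/2) ∑_{uv ∈ A} φ(d⁺(u), d⁻(v))`. -/
noncomputable def vdbI {n : ℕ} (A : Finset (Fin n × Fin n)) (φ : ℕ → ℕ → ℝ) : ℝ :=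
  (1 / 2 : ℝ) * ∑ a ∈ A, φ (outDeg A a.1) (inDeg A a.2)

/-- `D` is (isomorphic to) the out-star `K⃗_{1,n-1}`: all arcs from a center `c`. -/
def IsStarOut {n : ℕ} (A : Finset (Fin n × Fin n)) : Prop :=
  ∃ c : Fin n, A = Finset.univ.filter (fun a => a.1 = c ∧ a.2 ≠ c)

/-- `D` is (isomorphic to) the in-star `K⃗_{n-1,1}`: all arcs into a center `c`. -/
def IsStarIn {n : ℕ} (A : Finset (Fin n × Fin n)) : Prop :=
  ∃ c : Fin n, A = Finset.univ.filter (fun a => a.2 = c ∧ a.1 ≠ c)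

/-- `D` is the complete symmetric digraph `K⃡_n`: all ordered pairs of distinct vertices. -/
def IsCompleteSym {n : ℕ} (A : Finset (Fin n × Fin n)) : Prop :=
  A = Finset.univ.filter (fun a => a.1 ≠ a.2)

theorem sum_one_div_card_fiber {α β : Type*} [DecidableEq β] (A : Finset α) (f : α → β) :
    ∑ a ∈ A, (1 : ℝ) / ((A.filter (fun b => f b = f a)).card : ℝ) = (A.image f).card := by
  rw [← Finset.sum_fiberwise_of_maps_to (t := A.image f) (g := f)
    (fun a ha => Finset.mem_image_of_mem f ha), Finset.card_eq_sum_ones, Nat.cast_sum]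
  refine Finset.sum_congr rfl fun y hy => ?_
  have hne : ((A.filter (fun b => f b = y)).card : ℝ) ≠ 0 := by
    obtain ⟨a, ha, rfl⟩ := Finset.mem_image.1 hy
    have : (A.filter (fun b => f b = f a)).Nonempty := ⟨a, Finset.mem_filter.2 ⟨ha, rfl⟩⟩
    exact_mod_cast this.card_pos.ne'
  rw [Finset.sum_congr rfl (g := fun _ => (1 : ℝ) / ((A.filter (fun b => f b = y)).card : ℝ))
    (fun a ha => by rw [(Finset.mem_filter.1 ha).2])]
  rw [Finset.sum_const, nsmul_eq_mul, mul_one_div_cancel hne, Nat.cast_one]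

theorem one_le_outDeg_iff {n : ℕ} (A : Finset (Fin n × Fin n)) (w : Fin n) :
    1 ≤ outDeg A w ↔ w ∈ A.image Prod.fst := by
  simp [outDeg, Nat.one_le_iff_ne_zero]

theorem one_le_inDeg_iff {n : ℕ} (A : Finset (Fin n × Fin n)) (w : Fin n) :
    1 ≤ inDeg A w ↔ w ∈ A.image Prod.snd := by
  simp [inDeg, Nat.one_le_iff_ne_zero]

theorem outDeg_le {n : ℕ} {A : Finset (Fin n × Fin n)} (harc : ∀ a ∈ A, a.1 ≠ a.2)
    (u : Fin n) : outDeg A u ≤ n - 1 := by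
  have h : outDeg A u ≤ ((Finset.univ : Finset (Fin n)).erase u).card := by
    refine Finset.card_le_card_of_injOn Prod.snd ?_ ?_
    · rintro a ha
      have ha := Finset.mem_filter.1 ha
      simpa [← ha.2] using (harc a ha.1).symm
    · rintro a ha b hb h
      exact Prod.ext ((Finset.mem_filter.1 ha).2.trans (Finset.mem_filter.1 hb).2.symm) h
  simpa using h

theorem inDeg_le {n : ℕ} {A : Finset (Fin n × Fin n)} (harc : ∀ a ∈ A, a.1 ≠ a.2)
    (u : Fin n) : inDeg A u ≤ n - 1 := by
  have h : inDeg A u ≤ ((Finset.univ : Finset (Fin n)).erase u).card := by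
    refine Finset.card_le_card_of_injOn Prod.fst ?_ ?_
    · rintro a ha
      have ha := Finset.mem_filter.1 ha
      simpa [← ha.2] using harc a ha.1
    · rintro a ha b hb h
      exact Prod.ext h ((Finset.mem_filter.1 ha).2.trans (Finset.mem_filter.1 hb).2.symm)
  simpa using h

/-- The reciprocal degrees summed over all arcs count the vertices that are a tail and
those that are a head. -/
theorem sum_one_div_outDeg_add_one_div_inDeg {n : ℕ} (A : Finset (Fin n × Fin n)) :
    ∑ a ∈ A, ((1 : ℝ) / (outDeg A a.1 : ℝ) + 1 / (inDeg A a.2 : ℝ)) =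
      (A.image Prod.fst).card + (A.image Prod.snd).card := by
  rw [Finset.sum_add_distrib, ← sum_one_div_card_fiber A Prod.fst,
    ← sum_one_div_card_fiber A Prod.snd]
  rfl

theorem stmt1 (n : ℕ) (hn : 3 ≤ n) (φ : ℕ → ℕ → ℝ) (hsym : ∀ x y, φ x y = φ y x)
    (hnonneg : ∀ x y, 0 ≤ φ x y)
    (hφ : ∀ i j : ℕ, 1 ≤ i → i ≤ j → j ≤ n - 1 → ¬(i = 1 ∧ j = n - 1) →
      ((n : ℝ) - 1) / n * (1 / (i : ℝ) + 1 / (j : ℝ)) * φ 1 (n - 1) > φ i j)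
    (A : Finset (Fin n × Fin n)) (harc : ∀ a ∈ A, a.1 ≠ a.2)
    (hni : ∀ u : Fin n, outDeg A u ≠ 0 ∨ inDeg A u ≠ 0) :
    vdbI A φ ≤ ((n : ℝ) - 1) * φ 1 (n - 1) ∧
      (vdbI A φ = ((n : ℝ) - 1) * φ 1 (n - 1) ↔
        (∀ a ∈ A, (outDeg A a.1 = 1 ∧ inDeg A a.2 = n - 1) ∨
            (outDeg A a.1 = n - 1 ∧ inDeg A a.2 = 1)) ∧
          ∀ w : Fin n, 1 ≤ outDeg A w ∧ 1 ≤ inDeg A w) := by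
  have hn0 : (0 : ℝ) < n := by exact_mod_cast (by omega : 0 < n)
  have hn1 : (0 : ℝ) < (n : ℝ) - 1 := by
    have : (3 : ℝ) ≤ n := by exact_mod_cast hn
    linarith
  have hcast : ((n - 1 : ℕ) : ℝ) = (n : ℝ) - 1 := by
    rw [Nat.cast_sub (by omega), Nat.cast_one]
  set K := φ 1 (n - 1) with hK
  have hKpos : 0 < K := by
    have h := (hnonneg 1 1).trans_lt (hφ 1 1 le_rfl le_rfl (by omega) (by omega))
    refine pos_of_mul_pos_right h ?_
    positivity
  have hext : ((n : ℝ) - 1) / n * (1 / ((1 : ℕ) : ℝ) + 1 / ((n - 1 : ℕ) : ℝ)) * K = K := by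
    rw [hcast]
    have := hn1.ne'
    field_simp
    push_cast
    ring
  have hbound : ∀ i j : ℕ, 1 ≤ i → 1 ≤ j → i ≤ n - 1 → j ≤ n - 1 →
      φ i j ≤ ((n : ℝ) - 1) / n * (1 / (i : ℝ) + 1 / (j : ℝ)) * K ∧
      (φ i j = ((n : ℝ) - 1) / n * (1 / (i : ℝ) + 1 / (j : ℝ)) * K ↔
        (i = 1 ∧ j = n - 1) ∨ (i = n - 1 ∧ j = 1)) := by
    intro i j hi hj hi' hj'
    by_cases h1 : i = 1 ∧ j = n - 1
    · obtain ⟨rfl, rfl⟩ := h1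
      rw [hext]
      simp [hK]
    by_cases h2 : i = n - 1 ∧ j = 1
    · obtain ⟨rfl, rfl⟩ := h2
      rw [add_comm (1 / _ : ℝ), hext, hsym]
      simp [hK]
    have hlt : φ i j < ((n : ℝ) - 1) / n * (1 / (i : ℝ) + 1 / (j : ℝ)) * K := by
      rcases le_total i j with h | h
      · exact hφ i j hi h hj' h1
      · rw [hsym, add_comm (1 / _ : ℝ)]
        exact hφ j i hj h hi' (fun h => h2 ⟨h.2, h.1⟩)
    exact ⟨hlt.le, iff_of_false hlt.ne (by tauto)⟩
  have harcbound := fun a (ha : a ∈ A) => hbound (outDeg A a.1) (inDeg A a.2)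
    ((one_le_outDeg_iff A a.1).2 (Finset.mem_image_of_mem _ ha))
    ((one_le_inDeg_iff A a.2).2 (Finset.mem_image_of_mem _ ha))
    (outDeg_le harc _) (inDeg_le harc _)
  have hsum := Finset.sum_le_sum fun a ha => (harcbound a ha).1
  have hsumeq := Finset.sum_eq_sum_iff_of_le fun a ha => (harcbound a ha).1
  rw [← Finset.sum_mul, ← Finset.mul_sum, sum_one_div_outDeg_add_one_div_inDeg] at hsum hsumeq
  set p := (A.image Prod.fst).card with hp
  set q := (A.image Prod.snd).card with hq
  have hpn : p ≤ n := by simpa using Finset.card_le_univ (A.image Prod.fst)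
  have hqn : q ≤ n := by simpa using Finset.card_le_univ (A.image Prod.snd)
  have hpq : (p : ℝ) + q ≤ 2 * n := by exact_mod_cast (by omega : p + q ≤ 2 * n)
  have hc : 0 < ((n : ℝ) - 1) / n := div_pos hn1 hn0
  have hfull : ((n : ℝ) - 1) / n * (2 * n) * K = 2 * (((n : ℝ) - 1) * K) := by
    field_simp
  have hmono : ((n : ℝ) - 1) / n * (p + q) * K ≤ ((n : ℝ) - 1) / n * (2 * n) * K := by
    gcongr
  have hspan : (∀ w : Fin n, 1 ≤ outDeg A w ∧ 1 ≤ inDeg A w) ↔ (p : ℝ) + q = 2 * n := by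
    have hnat : (p : ℝ) + q = 2 * n ↔ p = n ∧ q = n := by
      norm_cast
      omega
    have hpu : p = n ↔ ∀ w, w ∈ A.image Prod.fst := by
      rw [← Finset.eq_univ_iff_forall, ← Finset.card_eq_iff_eq_univ, Fintype.card_fin]
    have hqu : q = n ↔ ∀ w, w ∈ A.image Prod.snd := by
      rw [← Finset.eq_univ_iff_forall, ← Finset.card_eq_iff_eq_univ, Fintype.card_fin]
    rw [hnat, hpu, hqu, ← forall_and]
    simp only [one_le_outDeg_iff, one_le_inDeg_iff]
  have harcs : (∀ a ∈ A, (outDeg A a.1 = 1 ∧ inDeg A a.2 = n - 1) ∨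
      (outDeg A a.1 = n - 1 ∧ inDeg A a.2 = 1)) ↔
      ∑ a ∈ A, φ (outDeg A a.1) (inDeg A a.2) = ((n : ℝ) - 1) / n * (p + q) * K := by
    rw [hsumeq]
    exact forall₂_congr fun a ha => (harcbound a ha).2.symm
  rw [hspan, harcs, vdbI]
  refine ⟨by linarith, fun h => ?_, fun ⟨h₁, h₂⟩ => ?_⟩
  · refine ⟨by linarith, ?_⟩
    have h' : ((n : ℝ) - 1) / n * (p + q) * K = ((n : ℝ) - 1) / n * (2 * n) * K := by linarith
    exact mul_left_cancel₀ hc.ne' (mul_right_cancel₀ hKpos.ne' h')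
  · rw [h₁, h₂, hfull]
    ring
end

section
/- Let n ≥ 2 and let α be a real number with α > −1/2. Then for every digraph D on n vertices without isolated vertices, R_α(D) ≤ (1/2)·n·(n−1)^{2α+1}, and equality holds if and only if D is isomorphic to the complete symmetric digraph K⃡_n. -/
open Finset

/-- Summing over `A` the inverse size of the fiber of `f` through each point counts the nonempty
fibers of `f`. -/
theorem sum_inv_card_fiber {ι κ : Type*} [DecidableEq κ] (A : Finset ι) (f : ι → κ) :
    ∑ a ∈ A, ((#{b ∈ A | f b = f a} : ℕ) : ℝ)⁻¹ = #(A.image f) := by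
  rw [← Finset.sum_fiberwise_of_maps_to (t := A.image f) (g := f)
    (fun a ha => mem_image_of_mem f ha), card_eq_sum_ones, Nat.cast_sum]
  refine sum_congr rfl fun u hu => ?_
  obtain ⟨a, ha, rfl⟩ := mem_image.1 hu
  have hne : ((#{b ∈ A | f b = f a} : ℕ) : ℝ) ≠ 0 := by
    have : 0 < #{b ∈ A | f b = f a} := card_pos.2 ⟨a, by simp [ha]⟩
    positivity
  rw [sum_congr rfl (g := fun _ => ((#{b ∈ A | f b = f a} : ℕ) : ℝ)⁻¹)
    (fun b hb => by rw [(mem_filter.1 hb).2]), sum_const, nsmul_eq_mul, mul_inv_cancel₀ hne]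
  simp

theorem rpow_mul_le_inv_add_inv {a b m α : ℝ} (ha : 0 < a) (hb : 0 < b) (ham : a ≤ m)
    (hbm : b ≤ m) (hα : -(1 / 2) < α) :
    (a * b) ^ α ≤ (a⁻¹ + b⁻¹) / 2 * m ^ (2 * α + 1) ∧
      ((a * b) ^ α = (a⁻¹ + b⁻¹) / 2 * m ^ (2 * α + 1) → a = m) := by
  have hm : 0 < m := ha.trans_le ham
  have hab : 0 < a * b := mul_pos ha hb
  have hsplit : (a * b) ^ α = (a * b) ^ (-(1 / 2) : ℝ) * (a * b) ^ (α + 1 / 2) := by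
    rw [← Real.rpow_add hab]; congr 1; ring
  have hpow : m ^ (2 * α + 1) = (m * m) ^ (α + 1 / 2) := by
    rw [Real.mul_rpow hm.le hm.le, ← Real.rpow_add hm]; congr 1; ring
  have hsq : ∀ x : ℝ, 0 < x → x⁻¹ = x ^ (-(1 / 2) : ℝ) * x ^ (-(1 / 2) : ℝ) := fun x hx => by
    rw [← Real.rpow_add hx, ← Real.rpow_neg_one]; norm_num
  have hamgm : (a * b) ^ (-(1 / 2) : ℝ) ≤ (a⁻¹ + b⁻¹) / 2 := by
    rw [Real.mul_rpow ha.le hb.le, hsq a ha, hsq b hb]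
    nlinarith [sq_nonneg (a ^ (-(1 / 2) : ℝ) - b ^ (-(1 / 2) : ℝ))]
  have hinv : 0 < (a⁻¹ + b⁻¹) / 2 := by positivity
  have hle : (a * b) ^ (α + 1 / 2) ≤ (m * m) ^ (α + 1 / 2) :=
    Real.rpow_le_rpow hab.le (mul_le_mul ham hbm hb.le hm.le) (by linarith)
  have hfirst : (a * b) ^ α ≤ (a⁻¹ + b⁻¹) / 2 * (a * b) ^ (α + 1 / 2) := by
    rw [hsplit]; gcongr
  refine ⟨hfirst.trans (by rw [hpow]; gcongr), fun h => ?_⟩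
  by_contra hne
  have hlt : (a * b) ^ (α + 1 / 2) < (m * m) ^ (α + 1 / 2) :=
    Real.rpow_lt_rpow hab.le (mul_lt_mul (lt_of_le_of_ne ham hne) hbm hb hm.le) (by linarith)
  rw [h, hpow] at hfirst
  exact absurd (le_of_mul_le_mul_left hfirst hinv) (not_le.2 hlt)

theorem outDeg_eq_card {n : ℕ} (A : Finset (Fin n × Fin n)) (u : Fin n) :
    outDeg A u = #{v | (u, v) ∈ A} := by
  refine card_bij' (fun a _ => a.2) (fun v _ => (u, v)) ?_ ?_ ?_ ?_ <;> simp +contextual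
  rintro a b h rfl
  exact h

theorem inDeg_eq_card {n : ℕ} (A : Finset (Fin n × Fin n)) (u : Fin n) :
    inDeg A u = #{v | (v, u) ∈ A} := by
  refine card_bij' (fun a _ => a.1) (fun v _ => (v, u)) ?_ ?_ ?_ ?_ <;> simp +contextual
  rintro a b h rfl
  exact h

theorem IsCompleteSym.outDeg_eq {n : ℕ} {A : Finset (Fin n × Fin n)} (h : IsCompleteSym A)
    (u : Fin n) : outDeg A u = n - 1 := by
  rw [outDeg_eq_card, h]
  simp [filter_ne]

theorem IsCompleteSym.inDeg_eq {n : ℕ} {A : Finset (Fin n × Fin n)} (h : IsCompleteSym A)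
    (u : Fin n) : inDeg A u = n - 1 := by
  rw [inDeg_eq_card, h]
  simp [filter_ne']

theorem card_eq_sum_outDeg {n : ℕ} (A : Finset (Fin n × Fin n)) :
    #A = ∑ u, outDeg A u :=
  card_eq_sum_card_fiberwise fun _ _ => mem_coe.2 (mem_univ _)

theorem isCompleteSym_of_outDeg_eq {n : ℕ} {A : Finset (Fin n × Fin n)}
    (harc : ∀ a ∈ A, a.1 ≠ a.2) (h : ∀ u, outDeg A u = n - 1) : IsCompleteSym A := by
  refine eq_of_subset_of_card_le (fun a ha => mem_filter.2 ⟨mem_univ a, harc a ha⟩) ?_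
  have hK : IsCompleteSym (univ.filter fun a : Fin n × Fin n => a.1 ≠ a.2) := rfl
  rw [card_eq_sum_outDeg, card_eq_sum_outDeg]
  exact sum_le_sum fun u _ => by rw [h u, hK.outDeg_eq u]

theorem stmt6 (n : ℕ) (hn : 2 ≤ n) (α : ℝ) (hα : -(1 / 2) < α)
    (A : Finset (Fin n × Fin n)) (harc : ∀ a ∈ A, a.1 ≠ a.2)
    (hni : ∀ u : Fin n, outDeg A u ≠ 0 ∨ inDeg A u ≠ 0) :
    vdbI A (fun x y => ((x : ℝ) * (y : ℝ)) ^ α) ≤ (1 / 2 : ℝ) * n * ((n : ℝ) - 1) ^ (2 * α + 1) ∧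
      (vdbI A (fun x y => ((x : ℝ) * (y : ℝ)) ^ α) = (1 / 2 : ℝ) * n * ((n : ℝ) - 1) ^ (2 * α + 1) ↔ IsCompleteSym A) := by
  have hm1 : ((n - 1 : ℕ) : ℝ) = (n : ℝ) - 1 := by push_cast [show 1 ≤ n by omega]; rfl
  have hm : (0 : ℝ) < (n : ℝ) - 1 := by
    have : (2 : ℝ) ≤ n := by exact_mod_cast hn
    linarith
  have hM : 0 < ((n : ℝ) - 1) ^ (2 * α + 1) := Real.rpow_pos_of_pos hm _
  have hterm : ∀ a ∈ A, _ := fun a ha =>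
    rpow_mul_le_inv_add_inv (a := outDeg A a.1) (b := inDeg A a.2) (m := (n : ℝ) - 1) (α := α)
      (Nat.cast_pos.2 (card_pos.2 ⟨a, by simp [ha]⟩))
      (Nat.cast_pos.2 (card_pos.2 ⟨a, by simp [ha]⟩))
      (hm1 ▸ Nat.cast_le.2 (outDeg_le harc a.1)) (hm1 ▸ Nat.cast_le.2 (inDeg_le harc a.2)) hα
  have hsum : ∑ a ∈ A, ((outDeg A a.1 : ℝ)⁻¹ + (inDeg A a.2 : ℝ)⁻¹) / 2 *
      ((n : ℝ) - 1) ^ (2 * α + 1) =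
      ((#(A.image Prod.fst) : ℝ) + #(A.image Prod.snd)) / 2 * ((n : ℝ) - 1) ^ (2 * α + 1) := by
    rw [← sum_mul, ← sum_div, sum_add_distrib, ← sum_inv_card_fiber A Prod.fst,
      ← sum_inv_card_fiber A Prod.snd]
    rfl
  have hle := sum_le_sum fun a ha => (hterm a ha).1
  rw [hsum] at hle
  have hfst : (#(A.image Prod.fst) : ℝ) ≤ n := by
    exact_mod_cast (card_le_univ _).trans_eq (Fintype.card_fin n)
  have hsnd : (#(A.image Prod.snd) : ℝ) ≤ n := by
    exact_mod_cast (card_le_univ _).trans_eq (Fintype.card_fin n)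
  have hcount : ((#(A.image Prod.fst) : ℝ) + #(A.image Prod.snd)) / 2 *
      ((n : ℝ) - 1) ^ (2 * α + 1) ≤ n * ((n : ℝ) - 1) ^ (2 * α + 1) := by
    gcongr; linarith
  unfold vdbI
  refine ⟨by linarith, fun h => ?_, fun h => ?_⟩
  · have himage : (n : ℝ) ≤ #(A.image Prod.fst) := by
      have : (n : ℝ) ≤ ((#(A.image Prod.fst) : ℝ) + #(A.image Prod.snd)) / 2 :=
        le_of_mul_le_mul_right (by linarith) hM
      linarith
    have huniv : A.image Prod.fst = univ := by
      refine (card_eq_iff_eq_univ _).1 (le_antisymm (card_le_univ _) ?_)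
      rw [Fintype.card_fin]
      exact_mod_cast himage
    have hall := (sum_eq_sum_iff_of_le fun a ha => (hterm a ha).1).1 (by rw [hsum]; linarith)
    refine isCompleteSym_of_outDeg_eq harc fun u => ?_
    obtain ⟨a, ha, rfl⟩ := mem_image.1 (huniv ▸ mem_univ u)
    have := (hterm a ha).2 (hall a ha)
    rw [← hm1] at this
    exact_mod_cast this
  · have hcard : (#A : ℝ) = n * ((n : ℝ) - 1) := by
      rw [card_eq_sum_outDeg, sum_congr rfl fun u _ => h.outDeg_eq u, ← hm1]
      simp
    rw [sum_congr rfl fun a _ => by rw [h.outDeg_eq, h.inDeg_eq], sum_const, nsmul_eq_mul, hcard]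
    beta_reduce
    rw [hm1, Real.mul_rpow hm.le hm.le, Real.rpow_add hm, two_mul, Real.rpow_add hm, Real.rpow_one]
    ring
end

section
/- Let n ≥ 3. Then for every digraph D on n vertices without isolated vertices, R_{−1/2}(D) ≥ (1/2)·√(n−1), and equality holds if and only if D is isomorphic to K⃗_{1,n−1} or to K⃗_{n−1,1}. -/
open Finset

section DegreeCounting

variable {n : ℕ} {A : Finset (Fin n × Fin n)}

lemma outDeg_le_card_image_snd (u : Fin n) : outDeg A u ≤ (A.image Prod.snd).card := by
  refine card_le_card_of_injOn Prod.snd ?_ ?_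
  · intro a ha
    exact mem_coe.2 (mem_image_of_mem _ (mem_filter.1 (mem_coe.1 ha)).1)
  · intro a ha b hb hab
    exact Prod.ext ((mem_filter.1 (mem_coe.1 ha)).2.trans (mem_filter.1 (mem_coe.1 hb)).2.symm) hab

lemma inDeg_le_card_image_fst (v : Fin n) : inDeg A v ≤ (A.image Prod.fst).card := by
  refine card_le_card_of_injOn Prod.fst ?_ ?_
  · intro a ha
    exact mem_coe.2 (mem_image_of_mem _ (mem_filter.1 (mem_coe.1 ha)).1)
  · intro a ha b hb hab
    exact Prod.ext hab ((mem_filter.1 (mem_coe.1 ha)).2.trans (mem_filter.1 (mem_coe.1 hb)).2.symm)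

lemma mem_image_fst_iff_outDeg_ne_zero (u : Fin n) :
    u ∈ A.image Prod.fst ↔ outDeg A u ≠ 0 := by
  simp only [outDeg, Ne, card_eq_zero, filter_eq_empty_iff, mem_image]
  push Not
  rfl

lemma mem_image_snd_iff_inDeg_ne_zero (v : Fin n) :
    v ∈ A.image Prod.snd ↔ inDeg A v ≠ 0 := by
  simp only [inDeg, Ne, card_eq_zero, filter_eq_empty_iff, mem_image]
  push Not
  rfl

lemma outDeg_pos {a : Fin n × Fin n} (ha : a ∈ A) : 0 < outDeg A a.1 :=
  Nat.pos_of_ne_zero ((mem_image_fst_iff_outDeg_ne_zero _).1 (mem_image_of_mem _ ha))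

lemma inDeg_pos {a : Fin n × Fin n} (ha : a ∈ A) : 0 < inDeg A a.2 :=
  Nat.pos_of_ne_zero ((mem_image_snd_iff_inDeg_ne_zero _).1 (mem_image_of_mem _ ha))

lemma sum_inv_outDeg : ∑ a ∈ A, ((outDeg A a.1 : ℝ))⁻¹ = (A.image Prod.fst).card := by
  rw [sum_comp (fun u => ((outDeg A u : ℝ))⁻¹) Prod.fst, card_eq_sum_ones, Nat.cast_sum]
  refine sum_congr rfl fun u hu => ?_
  have h : (outDeg A u : ℝ) ≠ 0 :=
    Nat.cast_ne_zero.2 ((mem_image_fst_iff_outDeg_ne_zero u).1 hu)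
  rw [nsmul_eq_mul, Nat.cast_one]
  exact mul_inv_cancel₀ h

lemma sum_inv_inDeg : ∑ a ∈ A, ((inDeg A a.2 : ℝ))⁻¹ = (A.image Prod.snd).card := by
  rw [sum_comp (fun v => ((inDeg A v : ℝ))⁻¹) Prod.snd, card_eq_sum_ones, Nat.cast_sum]
  refine sum_congr rfl fun v hv => ?_
  have h : (inDeg A v : ℝ) ≠ 0 :=
    Nat.cast_ne_zero.2 ((mem_image_snd_iff_inDeg_ne_zero v).1 hv)
  rw [nsmul_eq_mul, Nat.cast_one]
  exact mul_inv_cancel₀ h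

lemma le_card_image_fst_add_card_image_snd
    (hni : ∀ u : Fin n, outDeg A u ≠ 0 ∨ inDeg A u ≠ 0) :
    n ≤ (A.image Prod.fst).card + (A.image Prod.snd).card := by
  have h : (univ : Finset (Fin n)) ⊆ A.image Prod.fst ∪ A.image Prod.snd := fun u _ =>
    mem_union.2 ((hni u).imp (mem_image_fst_iff_outDeg_ne_zero u).2
      (mem_image_snd_iff_inDeg_ne_zero u).2)
  simpa using (card_le_card h).trans (card_union_le _ _)

end DegreeCounting

lemma mul_rpow_neg_half {x y : ℝ} (hx : 0 ≤ x) (hy : 0 ≤ y) :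
    (x * y) ^ (-(1 / 2) : ℝ) = (√x)⁻¹ * (√y)⁻¹ := by
  rw [Real.rpow_neg (mul_nonneg hx hy), ← Real.sqrt_eq_rpow, Real.sqrt_mul hx, mul_inv]

/-- The chord inequality `(tr - 1)(s - r) ≥ 0` for `r = √(y / x)`. -/
lemma div_add_div_le_mul_inv_sqrt {x y s t : ℝ} (hx : 1 ≤ x) (hy : 1 ≤ y)
    (hs : √y ≤ s) (ht : √x ≤ t) :
    t * x⁻¹ + s * y⁻¹ ≤ (s * t + 1) * ((√x)⁻¹ * (√y)⁻¹) := by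
  have hx1 : 1 ≤ √x := Real.one_le_sqrt.2 hx
  have hy1 : 1 ≤ √y := Real.one_le_sqrt.2 hy
  have hxx : √x ^ 2 = x := Real.sq_sqrt (by linarith)
  have hyy : √y ^ 2 = y := Real.sq_sqrt (by linarith)
  generalize √x = a at *
  generalize √y = b at *
  subst hxx hyy
  have h1 : 0 ≤ t * b - a := by nlinarith
  have h2 : 0 ≤ s * a - b := by nlinarith
  have ha : 0 < a := by linarith
  have hb : 0 < b := by linarith
  have key : (s * t + 1) * (a⁻¹ * b⁻¹) - (t * (a ^ 2)⁻¹ + s * (b ^ 2)⁻¹)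
      = (t * b - a) * (s * a - b) / (a ^ 2 * b ^ 2) := by
    field_simp
    ring
  have : 0 ≤ (t * b - a) * (s * a - b) / (a ^ 2 * b ^ 2) := by positivity
  linarith

lemma sqrt_mul_add_le_sum {n : ℕ} (A : Finset (Fin n × Fin n)) {p q : ℝ}
    (hp : p = (A.image Prod.fst).card) (hq : q = (A.image Prod.snd).card) :
    √p * √q * (√p + √q) ≤ (√p * √q + 1) *
      ∑ a ∈ A, ((outDeg A a.1 : ℝ) * (inDeg A a.2 : ℝ)) ^ (-(1 / 2) : ℝ) := by
  have hle : ∑ a ∈ A, (√q * ((outDeg A a.1 : ℝ))⁻¹ + √p * ((inDeg A a.2 : ℝ))⁻¹) ≤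
      ∑ a ∈ A, (√p * √q + 1) *
        ((outDeg A a.1 : ℝ) * (inDeg A a.2 : ℝ)) ^ (-(1 / 2) : ℝ) := by
    refine sum_le_sum fun a ha => ?_
    rw [mul_rpow_neg_half (Nat.cast_nonneg _) (Nat.cast_nonneg _)]
    refine div_add_div_le_mul_inv_sqrt (mod_cast outDeg_pos ha) (mod_cast inDeg_pos ha)
      (Real.sqrt_le_sqrt ?_) (Real.sqrt_le_sqrt ?_)
    · rw [hp]
      exact_mod_cast inDeg_le_card_image_fst a.2
    · rw [hq]
      exact_mod_cast outDeg_le_card_image_snd a.1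
  rw [sum_add_distrib, ← mul_sum, ← mul_sum, ← mul_sum, sum_inv_outDeg, sum_inv_inDeg,
    ← hp, ← hq] at hle
  have hpp : √p ^ 2 = p := Real.sq_sqrt (by rw [hp]; positivity)
  have hqq : √q ^ 2 = q := Real.sq_sqrt (by rw [hq]; positivity)
  calc √p * √q * (√p + √q) = √q * √p ^ 2 + √p * √q ^ 2 := by ring
    _ = √q * p + √p * q := by rw [hpp, hqq]
    _ ≤ _ := hle

lemma add_mul_le_sq_of_sqrt_mul_add_le {p q R : ℝ} (hp : 0 ≤ p) (hq : 0 ≤ q)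
    (h : √p * √q * (√p + √q) ≤ (√p * √q + 1) * R) :
    (2 * (√p * √q) + 1) * ((p - 1) * (q - 1)) + (√p * √q + 1) ^ 2 * (p + q - 1) ≤
      (√p * √q + 1) ^ 2 * R ^ 2 := by
  have hsq := pow_le_pow_left₀ (by positivity) h 2
  have hpp : √p ^ 2 = p := Real.sq_sqrt hp
  have hqq : √q ^ 2 = q := Real.sq_sqrt hq
  generalize √p = s at *
  generalize √q = t at *
  subst hpp hqq
  linarith

section Stars

variable {n : ℕ} {A : Finset (Fin n × Fin n)}

lemma isStarOut_of_card_image_fst_le_one (harc : ∀ a ∈ A, a.1 ≠ a.2)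
    (hni : ∀ u : Fin n, outDeg A u ≠ 0 ∨ inDeg A u ≠ 0) (hA : A.Nonempty)
    (h : (A.image Prod.fst).card ≤ 1) : IsStarOut A := by
  obtain ⟨a, ha⟩ := hA
  have hfst : ∀ b ∈ A.image Prod.fst, b = a.1 := fun b hb =>
    card_le_one.1 h b hb a.1 (mem_image_of_mem _ ha)
  refine ⟨a.1, ?_⟩
  ext ⟨u, v⟩
  simp only [mem_filter, mem_univ, true_and]
  constructor
  · intro huv
    have hu : u = a.1 := hfst u (mem_image_of_mem Prod.fst huv)
    exact ⟨hu, fun hv => harc _ huv (hu.trans hv.symm)⟩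
  · rintro ⟨rfl, hv⟩
    rcases hni v with h0 | h0
    · exact absurd (hfst v ((mem_image_fst_iff_outDeg_ne_zero v).2 h0)) hv
    · obtain ⟨⟨x, y⟩, hb, rfl⟩ := mem_image.1 ((mem_image_snd_iff_inDeg_ne_zero v).2 h0)
      rwa [← hfst x (mem_image_of_mem Prod.fst hb)]

lemma isStarIn_of_card_image_snd_le_one (harc : ∀ a ∈ A, a.1 ≠ a.2)
    (hni : ∀ u : Fin n, outDeg A u ≠ 0 ∨ inDeg A u ≠ 0) (hA : A.Nonempty)
    (h : (A.image Prod.snd).card ≤ 1) : IsStarIn A := by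
  obtain ⟨a, ha⟩ := hA
  have hsnd : ∀ b ∈ A.image Prod.snd, b = a.2 := fun b hb =>
    card_le_one.1 h b hb a.2 (mem_image_of_mem _ ha)
  refine ⟨a.2, ?_⟩
  ext ⟨u, v⟩
  simp only [mem_filter, mem_univ, true_and]
  constructor
  · intro huv
    have hv : v = a.2 := hsnd v (mem_image_of_mem Prod.snd huv)
    exact ⟨hv, fun hu => harc _ huv (hu.trans hv.symm)⟩
  · rintro ⟨rfl, hu⟩
    rcases hni u with h0 | h0
    · obtain ⟨⟨x, y⟩, hb, rfl⟩ := mem_image.1 ((mem_image_fst_iff_outDeg_ne_zero u).2 h0)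
      rwa [← hsnd y (mem_image_of_mem Prod.snd hb)]
    · exact absurd (hsnd u ((mem_image_snd_iff_inDeg_ne_zero u).2 h0)) hu

lemma card_mul_rpow_neg_half (m : ℕ) :
    (m : ℝ) * (m : ℝ) ^ (-(1 / 2) : ℝ) = √m := by
  rw [Real.rpow_neg (Nat.cast_nonneg _), ← Real.sqrt_eq_rpow, ← div_eq_mul_inv, Real.div_sqrt]

lemma IsStarOut.sum_rpow (h : IsStarOut A) :
    ∑ a ∈ A, ((outDeg A a.1 : ℝ) * (inDeg A a.2 : ℝ)) ^ (-(1 / 2) : ℝ) = √((n : ℝ) - 1) := by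
  obtain ⟨c, hc⟩ := h
  have hmem : ∀ a, a ∈ A ↔ a.1 = c ∧ a.2 ≠ c := by simp [hc]
  have hcard : A.card = n - 1 := by
    have : A = {c} ×ˢ univ.erase c := by
      ext ⟨u, v⟩
      simp only [hmem, mem_product, mem_singleton, mem_erase, mem_univ, and_true]
    rw [this, card_product, card_singleton, one_mul, card_erase_of_mem (mem_univ c), card_univ, Fintype.card_fin]
  have hout : outDeg A c = n - 1 := by
    rw [← hcard, outDeg, filter_true_of_mem fun a ha => ((hmem a).1 ha).1]
  have hin : ∀ a ∈ A, inDeg A a.2 = 1 := fun a ha => by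
    refine card_eq_one.2 ⟨a, ?_⟩
    ext b
    simp only [mem_filter, mem_singleton]
    refine ⟨fun hb => Prod.ext ?_ hb.2, ?_⟩
    · rw [((hmem a).1 ha).1, ((hmem b).1 hb.1).1]
    · rintro rfl
      exact ⟨ha, rfl⟩
  have hn : 1 ≤ n := c.pos
  rw [sum_congr rfl fun a ha => by rw [hin a ha, ((hmem a).1 ha).1, hout, Nat.cast_one, mul_one],
    sum_const, hcard, nsmul_eq_mul, card_mul_rpow_neg_half, Nat.cast_sub hn, Nat.cast_one]

lemma IsStarIn.sum_rpow (h : IsStarIn A) :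
    ∑ a ∈ A, ((outDeg A a.1 : ℝ) * (inDeg A a.2 : ℝ)) ^ (-(1 / 2) : ℝ) = √((n : ℝ) - 1) := by
  obtain ⟨c, hc⟩ := h
  have hmem : ∀ a, a ∈ A ↔ a.2 = c ∧ a.1 ≠ c := by simp [hc]
  have hcard : A.card = n - 1 := by
    have : A = univ.erase c ×ˢ {c} := by
      ext ⟨u, v⟩
      simp only [hmem, mem_product, mem_singleton, mem_erase, mem_univ, and_true]
      exact and_comm
    rw [this, card_product, card_singleton, mul_one, card_erase_of_mem (mem_univ c), card_univ, Fintype.card_fin]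
  have hin : inDeg A c = n - 1 := by
    rw [← hcard, inDeg, filter_true_of_mem fun a ha => ((hmem a).1 ha).1]
  have hout : ∀ a ∈ A, outDeg A a.1 = 1 := fun a ha => by
    refine card_eq_one.2 ⟨a, ?_⟩
    ext b
    simp only [mem_filter, mem_singleton]
    refine ⟨fun hb => Prod.ext hb.2 ?_, ?_⟩
    · rw [((hmem a).1 ha).1, ((hmem b).1 hb.1).1]
    · rintro rfl
      exact ⟨ha, rfl⟩
  have hn : 1 ≤ n := c.pos
  rw [sum_congr rfl fun a ha => by rw [hout a ha, ((hmem a).1 ha).1, hin, Nat.cast_one, one_mul],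
    sum_const, hcard, nsmul_eq_mul, card_mul_rpow_neg_half, Nat.cast_sub hn, Nat.cast_one]

end Stars

theorem stmt9 (n : ℕ) (hn : 3 ≤ n)
    (A : Finset (Fin n × Fin n)) (harc : ∀ a ∈ A, a.1 ≠ a.2)
    (hni : ∀ u : Fin n, outDeg A u ≠ 0 ∨ inDeg A u ≠ 0) :
    (1 / 2 : ℝ) * Real.sqrt ((n : ℝ) - 1) ≤ vdbI A (fun x y => ((x : ℝ) * (y : ℝ)) ^ (-(1 / 2) : ℝ)) ∧
      (vdbI A (fun x y => ((x : ℝ) * (y : ℝ)) ^ (-(1 / 2) : ℝ)) = (1 / 2 : ℝ) * Real.sqrt ((n : ℝ) - 1) ↔ IsStarOut A ∨ IsStarIn A) := by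
  have hA : A.Nonempty := by
    rcases hni ⟨0, by omega⟩ with h | h
    · exact image_nonempty.1 ⟨_, (mem_image_fst_iff_outDeg_ne_zero _).2 h⟩
    · exact image_nonempty.1 ⟨_, (mem_image_snd_iff_inDeg_ne_zero _).2 h⟩
  obtain ⟨p, hp⟩ : ∃ p : ℝ, p = (A.image Prod.fst).card := ⟨_, rfl⟩
  obtain ⟨q, hq⟩ : ∃ q : ℝ, q = (A.image Prod.snd).card := ⟨_, rfl⟩
  have hp1 : 1 ≤ p := by
    rw [hp]
    exact_mod_cast (hA.image Prod.fst).card_pos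
  have hq1 : 1 ≤ q := by
    rw [hq]
    exact_mod_cast (hA.image Prod.snd).card_pos
  have hpq : (n : ℝ) ≤ p + q := by
    rw [hp, hq]
    exact_mod_cast le_card_image_fst_add_card_image_snd hni
  have hsum := add_mul_le_sq_of_sqrt_mul_add_le (by linarith) (by linarith)
    (sqrt_mul_add_le_sum A hp hq)
  have hnonneg : 0 ≤ ∑ a ∈ A, ((outDeg A a.1 : ℝ) * (inDeg A a.2 : ℝ)) ^ (-(1 / 2) : ℝ) :=
    sum_nonneg fun a _ => by positivity
  have hcoef : 0 < 2 * (√p * √q) + 1 := by positivity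
  have hcoef' : 0 < (√p * √q + 1) ^ 2 := by positivity
  have hprod : 0 ≤ (p - 1) * (q - 1) := mul_nonneg (by linarith) (by linarith)
  simp only [vdbI, mul_le_mul_iff_of_pos_left (one_half_pos (α := ℝ)),
    mul_right_inj' (one_half_pos (α := ℝ)).ne']
  refine ⟨(Real.sqrt_le_left hnonneg).2 ?_, fun heq => ?_, ?_⟩
  · have h := mul_nonneg hcoef.le hprod
    have h' := le_of_mul_le_mul_left (le_of_add_le_of_nonneg_right hsum h) hcoef'
    linarith
  · have hn1 : (0 : ℝ) ≤ n - 1 := by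
      have : (3 : ℝ) ≤ n := mod_cast hn
      linarith
    rw [heq, Real.sq_sqrt hn1] at hsum
    have h' := mul_le_mul_of_nonneg_left (sub_le_sub_right hpq 1) hcoef'.le
    have hle : (p - 1) * (q - 1) ≤ 0 := nonpos_of_mul_nonpos_right (by linarith) hcoef
    rcases mul_eq_zero.1 (le_antisymm hle hprod) with h | h
    · refine Or.inl (isStarOut_of_card_image_fst_le_one harc hni hA ?_)
      have : ((A.image Prod.fst).card : ℝ) ≤ 1 := by linarith
      exact_mod_cast this
    · refine Or.inr (isStarIn_of_card_image_snd_le_one harc hni hA ?_)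
      have : ((A.image Prod.snd).card : ℝ) ≤ 1 := by linarith
      exact_mod_cast this
  · rintro (h | h)
    · exact h.sum_rpow
    · exact h.sum_rpow
end

section
/- Let n ≥ 2. Then for every digraph D on n vertices without isolated vertices, GA(D) ≤ (1/2)·n·(n−1), and equality holds if and only if D is isomorphic to the complete symmetric digraph K⃡_n. -/
open Finset

theorem two_mul_sqrt_mul_div_add_le_one (x y : ℕ) :
    2 * Real.sqrt ((x : ℝ) * (y : ℝ)) / ((x : ℝ) + (y : ℝ)) ≤ 1 := by
  have hx : (0 : ℝ) ≤ x := x.cast_nonneg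
  have hy : (0 : ℝ) ≤ y := y.cast_nonneg
  refine div_le_one_of_le₀ ?_ (by positivity)
  rw [Real.sqrt_mul hx]
  nlinarith [sq_nonneg (√(x : ℝ) - √(y : ℝ)), Real.sq_sqrt hx, Real.sq_sqrt hy]

theorem two_mul_sqrt_mul_self_div_add_self {x : ℝ} (hx : 0 < x) :
    2 * Real.sqrt (x * x) / (x + x) = 1 := by
  rw [Real.sqrt_mul_self hx.le]
  field_simp
  norm_num

theorem card_filter_fst_ne_snd (n : ℕ) :
    (((Finset.univ : Finset (Fin n × Fin n)).filter (fun a => a.1 ≠ a.2)).card : ℝ) =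
      n * ((n : ℝ) - 1) := by
  have h : (Finset.univ : Finset (Fin n × Fin n)).filter (fun a => a.1 ≠ a.2) =
      (Finset.univ : Finset (Fin n)).offDiag := by
    ext a
    simp
  rw [h, Finset.offDiag_card, Nat.cast_sub (by simpa using Nat.le_mul_self n)]
  simp
  ring

theorem outDeg_complete {n : ℕ} (u : Fin n) :
    outDeg (Finset.univ.filter (fun a : Fin n × Fin n => a.1 ≠ a.2)) u = n - 1 := by
  have h : (Finset.univ.filter (fun a : Fin n × Fin n => a.1 ≠ a.2)).filter (fun a => a.1 = u) =
      {u} ×ˢ Finset.univ.erase u := by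
    ext ⟨a, b⟩
    simp only [mem_filter, mem_univ, true_and, mem_product, mem_singleton, mem_erase]
    grind
  rw [outDeg, h]
  simp

theorem inDeg_complete {n : ℕ} (u : Fin n) :
    inDeg (Finset.univ.filter (fun a : Fin n × Fin n => a.1 ≠ a.2)) u = n - 1 := by
  have h : (Finset.univ.filter (fun a : Fin n × Fin n => a.1 ≠ a.2)).filter (fun a => a.2 = u) =
      Finset.univ.erase u ×ˢ {u} := by
    ext ⟨a, b⟩
    simp only [mem_filter, mem_univ, true_and, mem_product, mem_singleton, mem_erase]
    grind
  rw [inDeg, h]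
  simp

theorem stmt15 (n : ℕ) (hn : 2 ≤ n)
    (A : Finset (Fin n × Fin n)) (harc : ∀ a ∈ A, a.1 ≠ a.2)
    (hni : ∀ u : Fin n, outDeg A u ≠ 0 ∨ inDeg A u ≠ 0) :
    vdbI A (fun x y => 2 * Real.sqrt ((x : ℝ) * (y : ℝ)) / ((x : ℝ) + (y : ℝ))) ≤ (1 / 2 : ℝ) * n * ((n : ℝ) - 1) ∧
      (vdbI A (fun x y => 2 * Real.sqrt ((x : ℝ) * (y : ℝ)) / ((x : ℝ) + (y : ℝ))) = (1 / 2 : ℝ) * n * ((n : ℝ) - 1) ↔ IsCompleteSym A) := by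
  have hsub : A ⊆ Finset.univ.filter (fun a => a.1 ≠ a.2) := fun a ha => by
    simpa using harc a ha
  have hsum : vdbI A (fun x y => 2 * Real.sqrt ((x : ℝ) * (y : ℝ)) / ((x : ℝ) + (y : ℝ))) ≤
      (1 / 2 : ℝ) * A.card := by
    refine mul_le_mul_of_nonneg_left ?_ (by norm_num)
    simpa using Finset.sum_le_card_nsmul A _ (1 : ℝ)
      fun a _ => two_mul_sqrt_mul_div_add_le_one (outDeg A a.1) (inDeg A a.2)
  have hcard : (A.card : ℝ) ≤ n * ((n : ℝ) - 1) := by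
    rw [← card_filter_fst_ne_snd]
    exact_mod_cast Finset.card_le_card hsub
  refine ⟨by linarith, fun h => ?_, fun h => ?_⟩
  · refine Finset.eq_of_subset_of_card_le hsub ?_
    have hle : (n : ℝ) * ((n : ℝ) - 1) ≤ A.card := by linarith
    rw [← card_filter_fst_ne_snd] at hle
    exact_mod_cast hle
  · have hpos : (0 : ℝ) < ((n - 1 : ℕ) : ℝ) := by
      exact_mod_cast Nat.sub_pos_of_lt hn
    rw [h, vdbI]
    simp only [outDeg_complete, inDeg_complete, two_mul_sqrt_mul_self_div_add_self hpos,
      Finset.sum_const, nsmul_eq_mul, mul_one]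
    rw [card_filter_fst_ne_snd, mul_assoc]
end
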